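/- Fix a positive integer K, a regular Hausdorff topological space X with a point-countable basis 𝔅, and for each x ∈ X an enumeration ⟨U_{x,k} : k < ω⟩ of {U ∈ 𝔅 : x ∈ U}. Fix a colouring c assigning to every unordered pair of distinct elements of X a colour in {0,…,K−1}. Let H be a set such that every point of X is an element of H and every member of 𝔅 is an element of H. Let Λ ⊆ P_{ω1}(H) be stationary and let F : Λ → X be a function such that for every M ∈ Λ: F(M) ∉ M, and U_{F(M),k} ∈ M for every k < ω. Then there exist a fine normal ideal I on P_{ω1}(H) and a set A ⊆ Λ with A ∈ I⁺ such that (A, I) is a winning pair for c. -/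

import Mathlib

namespace Galvin

/-- `P_{ω₁}(H)`: the collection of countable subsets of `H`. -/
def Pom (H : Type u) : Set (Set H) := {M : Set H | M.Countable}

/-- An ideal on `P_{ω₁}(H)`: a proper collection of subsets of `P_{ω₁}(H)` closed under
subsets and finite unions. -/
structure IsIdeal (H : Type u) (I : Set (Set (Set H))) : Prop where
  subset_pom : ∀ A ∈ I, A ⊆ Pom H
  empty_mem : (∅ : Set (Set H)) ∈ I
  subset_mem : ∀ A ∈ I, ∀ B : Set (Set H), B ⊆ A → B ∈ I
  union_mem : ∀ A ∈ I, ∀ B ∈ I, A ∪ B ∈ I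
  proper : Pom H ∉ I

/-- ℵ₁-completeness: closure under countable unions. -/
def IsComplete {H : Type u} (I : Set (Set (Set H))) : Prop :=
  ∀ A : ℕ → Set (Set H), (∀ n, A n ∈ I) → (⋃ n, A n) ∈ I

/-- A fine ideal: an ℵ₁-complete ideal containing `{M : x ∉ M}` for every `x ∈ H`. -/
def IsFineIdeal (H : Type u) (I : Set (Set (Set H))) : Prop :=
  IsIdeal H I ∧ IsComplete I ∧ ∀ x : H, {M ∈ Pom H | x ∉ M} ∈ I

/-- Normality: closure under diagonal unions. -/
def IsNormal (H : Type u) (I : Set (Set (Set H))) : Prop :=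
  ∀ A : H → Set (Set H), (∀ x, A x ∈ I) → {M ∈ Pom H | ∃ x ∈ M, M ∈ A x} ∈ I

/-- `I⁺`: the `I`-positive subsets of `P_{ω₁}(H)`. -/
def pos (H : Type u) (I : Set (Set (Set H))) : Set (Set (Set H)) :=
  {A | A ⊆ Pom H ∧ A ∉ I}

/-- `I*`: the dual filter of `I`. -/
def star (H : Type u) (I : Set (Set (Set H))) : Set (Set (Set H)) :=
  {A | Pom H \ A ∈ I}

/-- `I + A`: the ideal `{B : B ∩ A ∈ I}`. -/
def add (H : Type u) (I : Set (Set (Set H))) (A : Set (Set H)) : Set (Set (Set H)) :=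
  {B | B ⊆ Pom H ∧ B ∩ A ∈ I}

end Galvin
namespace Galvin

/-- `∃^I M ∈ A, φ(M)`: the set of `M ∈ A` with `φ(M)` is `(I+A)`-positive. -/
def eIdeal {H : Type u} (I : Set (Set (Set H))) (A : Set (Set H)) (φ : Set H → Prop) : Prop :=
  {M ∈ A | φ M} ∈ pos H (add H I A)

/-- `∀^I M ∈ A, φ(M)`: the set of `M ∈ A` with `φ(M)` is in the dual filter `(I+A)*`. -/
def aIdeal {H : Type u} (I : Set (Set (Set H))) (A : Set (Set H)) (φ : Set H → Prop) : Prop :=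
  {M ∈ A | φ M} ∈ star H (add H I A)

/-- `(A, B)` is weakly `(i,j)`-saturated over `I`. -/
def WeaklySat {H : Type u} {X : Type v} {K : ℕ} (c : Sym2 X → Fin K)
    (I : Set (Set (Set H))) (F : Set H → X) (A B : Set (Set H)) (i j : Fin K) : Prop :=
  eIdeal I A (fun M => eIdeal I B (fun N => F M ≠ F N ∧ c s(F M, F N) = i)) ∧
  eIdeal I B (fun N => eIdeal I A (fun M => F M ≠ F N ∧ c s(F M, F N) = j))

/-- `(A, B)` is `(i,j)`-saturated over `I`: every pair of `I`-positive subsets is weakly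
`(i,j)`-saturated over `I`. -/
def Sat {H : Type u} {X : Type v} {K : ℕ} (c : Sym2 X → Fin K)
    (I : Set (Set (Set H))) (F : Set H → X) (A B : Set (Set H)) (i j : Fin K) : Prop :=
  ∀ C, C ⊆ A → C ∈ pos H I → ∀ D, D ⊆ B → D ∈ pos H I → WeaklySat c I F C D i j

/-- `(A, B)` is `P`-unsaturated over `I`: for no `(i,j) ∈ P` is `(A,B)` weakly
`(i,j)`-saturated over `I`. -/
def Unsat {H : Type u} {X : Type v} {K : ℕ} (c : Sym2 X → Fin K)
    (I : Set (Set (Set H))) (F : Set H → X) (A B : Set (Set H))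
    (P : Set (Fin K × Fin K)) : Prop :=
  ∀ p ∈ P, ¬ WeaklySat c I F A B p.1 p.2

end Galvin
namespace Galvin

/-- A club in `P_{ω₁}(H)`: a cofinal collection of countable subsets of `H` closed under
unions of nonempty countable `⊆`-chains. -/
def IsClub (H : Type u) (C : Set (Set H)) : Prop :=
  C ⊆ Pom H ∧ (∀ N ∈ Pom H, ∃ M ∈ C, N ⊆ M) ∧
    ∀ D : Set (Set H), D ⊆ C → D.Nonempty → D.Countable → IsChain (· ⊆ ·) D → ⋃₀ D ∈ C

/-- A stationary subset of `P_{ω₁}(H)`: one meeting every club. -/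
def IsStationary (H : Type u) (S : Set (Set H)) : Prop :=
  S ⊆ Pom H ∧ ∀ C : Set (Set H), IsClub H C → (S ∩ C).Nonempty

end Galvin
namespace Galvin

/-- `x` is an `(i,j)`-winner below `B` over `I` (relative to `F`, `c` and the chosen
neighbourhood enumerations `U`). -/
def IsWinner {H : Type u} {X : Type v} {K : ℕ} (c : Sym2 X → Fin K)
    (I : Set (Set (Set H))) (F : Set H → X) (U : X → ℕ → Set X)
    (B : Set (Set H)) (i j : Fin K) (x : X) : Prop :=
  (∃ M ∈ B, F M = x) ∧
  ∃ T : ℕ → Set (Set H),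
    (∀ k, T k ⊆ B ∧ T k ∈ pos H I) ∧
    (∀ k, ∀ N ∈ T k, F N ≠ x ∧ c s(x, F N) = i) ∧
    (∀ k l, k < l → Sat c I F (T l) (T k) i j) ∧
    (∀ k, ∀ N ∈ T k, F N ∈ U x k)

/-- `(A, I)` is an `(i,j)`-winning pair: below every `I`-positive `B ⊆ A` there is an
`(i,j)`-winner over `I`. -/
def IsWinningPairFor {H : Type u} {X : Type v} {K : ℕ} (c : Sym2 X → Fin K)
    (I : Set (Set (Set H))) (F : Set H → X) (U : X → ℕ → Set X)
    (A : Set (Set H)) (i j : Fin K) : Prop :=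
  ∀ B, B ⊆ A → B ∈ pos H I → ∃ x : X, IsWinner c I F U B i j x

/-- `(A, I)` is a winning pair for `c`. -/
def IsWinningPair {H : Type u} {X : Type v} {K : ℕ} (c : Sym2 X → Fin K)
    (I : Set (Set (Set H))) (F : Set H → X) (U : X → ℕ → Set X)
    (A : Set (Set H)) : Prop :=
  ∃ i j : Fin K, IsWinningPairFor c I F U A i j

end Galvin

namespace Galvin

/-! ### Unions indexed by a relation and the nonstationary ideal -/

section RelUnion

variable {H : Type u}

/-- The union of the `A x`, where `A x` only contributes those `M` with `r x M`. Countable unions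
and diagonal unions are both of this form. -/
def relUnion {ι : Type w} (r : ι → Set H → Prop) (A : ι → Set (Set H)) : Set (Set H) :=
  {M ∈ Pom H | ∃ x, r x M ∧ M ∈ A x}

/-- A relation between indices and sets that is monotone, holds for countably many indices at every
countable set, and reflects unions of nonempty families. -/
structure IsContinuousRel {ι : Type w} (r : ι → Set H → Prop) : Prop where
  mono : ∀ x M N, M ⊆ N → r x M → r x N
  countable : ∀ M ∈ Pom H, {x | r x M}.Countable
  sUnion : ∀ x, ∀ D : Set (Set H), D.Nonempty → r x (⋃₀ D) → ∃ N ∈ D, r x N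

theorem isContinuousRel_mem : IsContinuousRel (fun (x : H) M => x ∈ M) where
  mono _ _ _ h hx := h hx
  countable _ hM := hM
  sUnion _ _ _ h := h

theorem isContinuousRel_true {ι : Type w} [Countable ι] :
    IsContinuousRel (fun (_ : ι) (_ : Set H) => True) where
  mono _ _ _ _ h := h
  countable _ _ := Set.to_countable _
  sUnion _ _ hD _ := ⟨_, hD.some_mem, trivial⟩

theorem relUnion_true_eq {A : ℕ → Set (Set H)} (hA : ∀ n, A n ⊆ Pom H) :
    relUnion (fun (_ : ℕ) (_ : Set H) => True) A = ⋃ n, A n := by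
  ext M
  simp only [relUnion, Set.mem_ofPred_eq, true_and, Set.mem_iUnion]
  exact ⟨fun h => h.2, fun ⟨n, h⟩ => ⟨hA n h, n, h⟩⟩

theorem isClub_pom : IsClub H (Pom H) :=
  ⟨subset_rfl, fun N hN => ⟨N, hN, subset_rfl⟩, fun _ hD _ hc _ => hc.sUnion fun _ hM => hD hM⟩

theorem isClub_mem (x : H) : IsClub H {M ∈ Pom H | x ∈ M} := by
  refine ⟨fun M hM => hM.1, fun N hN => ⟨insert x N, ⟨hN.insert x, Set.mem_insert x N⟩,
    Set.subset_insert x N⟩, fun D hD hne hc _ => ⟨hc.sUnion fun M hM => (hD hM).1, ?_⟩⟩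
  obtain ⟨M, hM⟩ := hne
  exact ⟨M, hM, (hD hM).2⟩

theorem IsClub.relInter {ι : Type w} {r : ι → Set H → Prop} (hr : IsContinuousRel r)
    {C : ι → Set (Set H)} (hC : ∀ x, IsClub H (C x)) :
    IsClub H {M ∈ Pom H | ∀ x, r x M → M ∈ C x} := by
  refine ⟨fun M hM => hM.1, fun N hN => ?_, fun D hD hne hc hch =>
    ⟨hc.sUnion fun M hM => (hD hM).1, fun x hx => ?_⟩⟩
  · have hex : ∀ x (M : Pom H), ∃ M' ∈ C x, (M : Set H) ⊆ M' := fun x M => (hC x).2.1 M M.2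
    choose f hfC hfs using hex
    have hcount : ∀ M : Pom H, ((M : Set H) ∪ ⋃ x ∈ {x | r x M}, f x M) ∈ Pom H := fun M =>
      Set.Countable.union M.2
        ((hr.countable M M.2).biUnion fun x _ => (hC x).1 (hfC x M))
    let g : ℕ → Pom H := fun n => (fun M => (⟨_, hcount M⟩ : Pom H))^[n] ⟨N, hN⟩
    have hstep : ∀ n, (g (n + 1)).1 = (g n).1 ∪ ⋃ x ∈ {x | r x (g n).1}, f x (g n) := fun n =>
      congrArg Subtype.val (Function.iterate_succ_apply' _ n _)
    have hmono : Monotone fun n => (g n : Set H) := monotone_nat_of_le_succ fun n => by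
      change (g n : Set H) ⊆ g (n + 1)
      rw [hstep]
      exact Set.subset_union_left
    have hf_sub : ∀ n x, r x (g n) → f x (g n) ⊆ g (n + 1) := fun n x h => by
      rw [hstep]
      exact Set.subset_union_of_subset_right
        (Set.subset_biUnion_of_mem (u := fun x => f x (g n)) h) _
    refine ⟨⋃₀ Set.range fun n => (g n : Set H), ⟨?_, fun x hx => ?_⟩,
      Set.subset_sUnion_of_mem ⟨0, rfl⟩⟩
    · exact (Set.countable_range _).sUnion (by rintro _ ⟨n, rfl⟩; exact (g n).2)
    · obtain ⟨_, ⟨n, rfl⟩, hn⟩ := hr.sUnion x _ (Set.range_nonempty _) hx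
      have hrm : ∀ m, r x (g (n + m)) := fun m =>
        hr.mono x _ _ (hmono (Nat.le_add_right n m)) hn
      have heq : (⋃₀ Set.range fun n => (g n : Set H)) =
          ⋃₀ Set.range fun m => f x (g (n + m)) := by
        apply subset_antisymm
        · rintro y ⟨_, ⟨m, rfl⟩, hy⟩
          exact ⟨_, ⟨m, rfl⟩, hfs x _ (hmono (Nat.le_add_left m n) hy)⟩
        · rintro y ⟨_, ⟨m, rfl⟩, hy⟩
          exact ⟨_, ⟨n + m + 1, rfl⟩, hf_sub _ x (hrm m) hy⟩
      rw [heq]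
      refine (hC x).2.2 _ (by rintro _ ⟨m, rfl⟩; exact hfC _ _) (Set.range_nonempty _)
        (Set.countable_range _) (Monotone.isChain_range ?_)
      exact monotone_nat_of_le_succ fun m =>
        (hf_sub _ x (hrm m)).trans (hfs x (g (n + (m + 1))))
  · obtain ⟨N, hN, hrN⟩ := hr.sUnion x D hne hx
    have heq : ⋃₀ D = ⋃₀ {M ∈ D | r x M} := by
      apply subset_antisymm
      · rintro y ⟨M, hM, hy⟩
        rcases hch.total hM hN with h | h
        · exact ⟨N, ⟨hN, hrN⟩, h hy⟩
        · exact ⟨M, ⟨hM, hr.mono x _ _ h hrN⟩, hy⟩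
      · exact Set.sUnion_mono fun M hM => hM.1
    rw [heq]
    exact (hC x).2.2 _ (fun M hM => (hD hM.1).2 x hM.2) ⟨N, hN, hrN⟩
      (hc.mono fun M hM => hM.1) (hch.mono fun M hM => hM.1)

end RelUnion

/-! ### Fine normal ideals concentrating on a set -/

/-- A fine normal ideal on `P_{ω₁}(H)` whose dual filter contains `Λ`. -/
structure IsFineNormalOn {H : Type u} (Λ : Set (Set H)) (J : Set (Set (Set H))) : Prop where
  fine : IsFineIdeal H J
  normal : IsNormal H J
  compl_mem : Pom H \ Λ ∈ J

namespace IsFineNormalOn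

variable {H : Type u} {Λ : Set (Set H)} {J : Set (Set (Set H))}

theorem of_relUnion (hsub : ∀ A ∈ J, A ⊆ Pom H) (hmono : ∀ A ∈ J, ∀ B ⊆ A, B ∈ J)
    (hproper : Pom H ∉ J) (hfine : ∀ x : H, {M ∈ Pom H | x ∉ M} ∈ J) (hΛ : Pom H \ Λ ∈ J)
    (hcomp : ∀ A : ℕ → Set (Set H), (∀ n, A n ∈ J) →
      relUnion (fun (_ : ℕ) (_ : Set H) => True) A ∈ J)
    (hnorm : ∀ A : H → Set (Set H), (∀ x, A x ∈ J) → relUnion (fun x M => x ∈ M) A ∈ J) :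
    IsFineNormalOn Λ J := by
  refine ⟨⟨⟨hsub, hmono _ hΛ _ (Set.empty_subset _), hmono, fun A hA B hB => ?_, hproper⟩,
    fun A hA => ?_, hfine⟩, hnorm, hΛ⟩
  · refine hmono _ (hcomp (fun n => if n = 0 then A else B) fun n => ?_) _ ?_
    · split_ifs <;> assumption
    · rintro M (hM | hM)
      · exact ⟨hsub _ hA hM, 0, trivial, by simpa using hM⟩
      · exact ⟨hsub _ hB hM, 1, trivial, by simpa using hM⟩
  · rw [← relUnion_true_eq fun n => hsub _ (hA n)]
    exact hcomp A hA

theorem mono (hJ : IsFineNormalOn Λ J) {A B : Set (Set H)} (hA : A ∈ J) (hBA : B ⊆ A) : B ∈ J :=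
  hJ.fine.1.subset_mem A hA B hBA

theorem subset_pom (hJ : IsFineNormalOn Λ J) {A : Set (Set H)} (hA : A ∈ J) : A ⊆ Pom H :=
  hJ.fine.1.subset_pom A hA

theorem union_mem (hJ : IsFineNormalOn Λ J) {A B : Set (Set H)} (hA : A ∈ J) (hB : B ∈ J) :
    A ∪ B ∈ J :=
  hJ.fine.1.union_mem A hA B hB

theorem relUnion_true_mem (hJ : IsFineNormalOn Λ J) {A : ℕ → Set (Set H)} (hA : ∀ n, A n ∈ J) :
    relUnion (fun (_ : ℕ) (_ : Set H) => True) A ∈ J := by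
  rw [relUnion_true_eq fun n => hJ.subset_pom (hA n)]
  exact hJ.fine.2.1 A hA

theorem relUnion_mem_mem (hJ : IsFineNormalOn Λ J) {A : H → Set (Set H)} (hA : ∀ x, A x ∈ J) :
    relUnion (fun x M => x ∈ M) A ∈ J :=
  hJ.normal A hA

theorem diff_notMem (hJ : IsFineNormalOn Λ J) {A B : Set (Set H)} (hA : A ∉ J) (hB : B ∈ J) :
    A \ B ∉ J := fun h =>
  hA (hJ.mono (hJ.union_mem h hB) (by rw [Set.sdiff_union_self]; exact Set.subset_union_left))

theorem pos_diff (hJ : IsFineNormalOn Λ J) {A B : Set (Set H)} (hA : A ∈ pos H J) (hB : B ∈ J) :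
    A \ B ∈ pos H J :=
  ⟨Set.sdiff_subset.trans hA.1, hJ.diff_notMem hA.2 hB⟩

theorem mem_pos_self (hJ : IsFineNormalOn Λ J) (hΛ : Λ ⊆ Pom H) : Λ ∈ pos H J :=
  ⟨hΛ, fun h => hJ.fine.1.proper (hJ.mono (hJ.union_mem h hJ.compl_mem) fun M hM => by
    by_cases hM' : M ∈ Λ
    exacts [Or.inl hM', Or.inr ⟨hM, hM'⟩])⟩

theorem inter_mem_pos (hJ : IsFineNormalOn Λ J) {A : Set (Set H)} (hA : A ∈ pos H J) :
    A ∩ Λ ∈ pos H J := by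
  have h := hJ.pos_diff hA hJ.compl_mem
  have heq : A \ (Pom H \ Λ) = A ∩ Λ := by
    ext M
    constructor
    · rintro ⟨h1, h2⟩
      exact ⟨h1, by_contra fun h3 => h2 ⟨hA.1 h1, h3⟩⟩
    · rintro ⟨h1, h2⟩
      exact ⟨h1, fun h3 => h3.2 h2⟩
  rwa [heq] at h

theorem eIdeal_iff {A : Set (Set H)} (hA : A ⊆ Pom H)
    (φ : Set H → Prop) : eIdeal J A φ ↔ {M ∈ A | φ M} ∉ J := by
  have h : {M ∈ A | φ M} ∩ A = {M ∈ A | φ M} := Set.inter_eq_left.2 fun M hM => hM.1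
  have h' : {M ∈ A | φ M} ⊆ Pom H := fun M hM => hA hM.1
  simp only [eIdeal, pos, add, Set.mem_ofPred_eq, h, not_and]
  exact ⟨fun h2 => h2.2 h', fun h2 => ⟨h', fun _ => h2⟩⟩

/-- Restricting an ideal to a positive set. -/
theorem restrict (hJ : IsFineNormalOn Λ J) {C : Set (Set H)} (hC : C ∈ pos H J) :
    IsFineNormalOn Λ (add H J C) := by
  refine of_relUnion (fun A hA => hA.1)
    (fun A hA B hB => ⟨hB.trans hA.1, hJ.mono hA.2 (Set.inter_subset_inter_left _ hB)⟩)
    (fun h => hC.2 (hJ.mono h.2 fun M hM => ⟨hC.1 hM, hM⟩))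
    (fun x => ⟨fun M hM => hM.1, hJ.mono (hJ.fine.2.2 x) Set.inter_subset_left⟩)
    ⟨Set.sdiff_subset, hJ.mono hJ.compl_mem Set.inter_subset_left⟩
    (fun A hA => ⟨fun M hM => hM.1, hJ.mono (hJ.relUnion_true_mem fun n => (hA n).2) ?_⟩)
    (fun A hA => ⟨fun M hM => hM.1, hJ.mono (hJ.relUnion_mem_mem fun n => (hA n).2) ?_⟩)
  all_goals
    rintro M ⟨⟨hM, x, hx, hMx⟩, hMC⟩
    exact ⟨hM, x, hx, hMx, hMC⟩

theorem subset_add (hJ : IsFineNormalOn Λ J) (C : Set (Set H)) : J ⊆ add H J C := fun _ hA =>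
  ⟨hJ.subset_pom hA, hJ.mono hA Set.inter_subset_left⟩

/-- The nonstationary ideal restricted to a stationary set. -/
theorem nonstationary (hΛ : IsStationary H Λ) :
    IsFineNormalOn Λ {E | E ⊆ Pom H ∧ ∃ C, IsClub H C ∧ E ∩ Λ ∩ C = ∅} := by
  have hrel : ∀ {ι : Type u} {r : ι → Set H → Prop}, IsContinuousRel r → ∀ A : ι → Set (Set H),
      (∀ x, A x ⊆ Pom H ∧ ∃ C, IsClub H C ∧ A x ∩ Λ ∩ C = ∅) →
      relUnion r A ⊆ Pom H ∧ ∃ C, IsClub H C ∧ relUnion r A ∩ Λ ∩ C = ∅ := by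
    intro ι r hr A hA
    choose _ C hC hAC using hA
    refine ⟨fun M hM => hM.1, _, IsClub.relInter hr hC, Set.eq_empty_of_forall_notMem ?_⟩
    rintro M ⟨⟨⟨_, x, hx, hMx⟩, hMΛ⟩, _, hM⟩
    exact (hAC x).subset ⟨⟨hMx, hMΛ⟩, hM x hx⟩
  refine of_relUnion (fun A hA => hA.1) ?_ ?_ ?_ ?_ ?_ (hrel isContinuousRel_mem)
  · rintro A ⟨hA, C, hC, hAC⟩ B hB
    exact ⟨hB.trans hA, C, hC, Set.subset_eq_empty (by gcongr) hAC⟩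
  · rintro ⟨_, C, hC, hAC⟩
    obtain ⟨M, hM, hMC⟩ := hΛ.2 C hC
    exact hAC.subset ⟨⟨hΛ.1 hM, hM⟩, hMC⟩
  · refine fun x => ⟨fun M hM => hM.1, _, isClub_mem x, Set.eq_empty_of_forall_notMem ?_⟩
    rintro M ⟨⟨⟨_, h⟩, _⟩, _, h'⟩
    exact h h'
  · refine ⟨Set.sdiff_subset, _, isClub_pom, Set.eq_empty_of_forall_notMem ?_⟩
    rintro M ⟨⟨⟨_, h⟩, h'⟩, _⟩
    exact h h'
  · intro A hA
    have := hrel (isContinuousRel_true (ι := ULift.{u} ℕ)) (fun n => A n.down) fun n => hA n.down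
    have heq : relUnion (fun (_ : ULift.{u} ℕ) (_ : Set H) => True) (fun n => A n.down) =
        relUnion (fun (_ : ℕ) (_ : Set H) => True) A := by
      ext M
      simp [relUnion]
    rwa [heq] at this

end IsFineNormalOn

end Galvin

namespace Galvin

/-! ### Absolute unsaturation -/

section AbsUnsat

variable {H : Type u} {X : Type v} {K : ℕ} {Λ : Set (Set H)} {J : Set (Set (Set H))}
  {F : Set H → X} {eP : X → H} {c : Sym2 X → Fin K} {C D : Set (Set H)}

theorem IsFineNormalOn.exists_pos_forall_not (hJ : IsFineNormalOn Λ J)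
    (heP : Function.Injective eP) (Q : X → X → Prop) (hC : C ∈ pos H J) (hD : D ∈ pos H J)
    (h : ¬ eIdeal J C fun M => eIdeal J D fun N => Q (F M) (F N)) :
    ∃ C' ⊆ C, C' ∈ pos H J ∧ ∃ D' ⊆ D, D' ∈ pos H J ∧
      ∀ M ∈ C', ∀ N ∈ D', eP (F M) ∈ N → ¬ Q (F M) (F N) := by
  rw [IsFineNormalOn.eIdeal_iff hC.1, not_not] at h
  set C' := C \ {M ∈ C | eIdeal J D fun N => Q (F M) (F N)}
  have hA : ∀ x : H, {N ∈ D | ∃ M ∈ C', eP (F M) = x ∧ Q (F M) (F N)} ∈ J := by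
    intro x
    by_cases hx : ∃ M ∈ C', eP (F M) = x
    · obtain ⟨M, hM, rfl⟩ := hx
      have hM' : ¬ eIdeal J D fun N => Q (F M) (F N) := fun h' => hM.2 ⟨hM.1, h'⟩
      rw [IsFineNormalOn.eIdeal_iff hD.1, not_not] at hM'
      refine hJ.mono hM' ?_
      rintro N ⟨hN, M', -, hMM', hQ⟩
      rw [heP hMM'] at hQ
      exact ⟨hN, hQ⟩
    · refine hJ.mono hJ.fine.1.empty_mem ?_
      rintro N ⟨-, M, hM, hMx, -⟩
      exact hx ⟨M, hM, hMx⟩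
  refine ⟨C', Set.sdiff_subset, hJ.pos_diff hC h, _, Set.sdiff_subset,
    hJ.pos_diff hD (hJ.relUnion_mem_mem hA), ?_⟩
  rintro M hM N ⟨hND, hN⟩ hMN hQ
  exact hN ⟨hD.1 hND, _, hMN, hND, M, hM, rfl, hQ⟩

/-- An ideal-free strengthening of the failure of weak `(i,j)`-saturation. -/
def AbsUnsat (c : Sym2 X → Fin K) (F : Set H → X) (eP : X → H) (C D : Set (Set H))
    (i j : Fin K) : Prop :=
  (∀ M ∈ C, ∀ N ∈ D, eP (F M) ∈ N → ¬ (F M ≠ F N ∧ c s(F M, F N) = i)) ∨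
    ∀ N ∈ D, ∀ M ∈ C, eP (F N) ∈ M → ¬ (F M ≠ F N ∧ c s(F M, F N) = j)

theorem AbsUnsat.mono {i j : Fin K} (h : AbsUnsat c F eP C D i j) {C' D' : Set (Set H)}
    (hC : C' ⊆ C) (hD : D' ⊆ D) : AbsUnsat c F eP C' D' i j :=
  h.imp (fun h M hM N hN => h M (hC hM) N (hD hN)) (fun h N hN M hM => h N (hD hN) M (hC hM))

theorem IsFineNormalOn.exists_absUnsat (hJ : IsFineNormalOn Λ J) (heP : Function.Injective eP)
    (hC : C ∈ pos H J) (hD : D ∈ pos H J) {i j : Fin K} (h : ¬ WeaklySat c J F C D i j) :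
    ∃ C' ⊆ C, C' ∈ pos H J ∧ ∃ D' ⊆ D, D' ∈ pos H J ∧ AbsUnsat c F eP C' D' i j := by
  rw [WeaklySat, not_and_or] at h
  rcases h with h | h
  · obtain ⟨C', hC', hC'J, D', hD', hD'J, h'⟩ :=
      hJ.exists_pos_forall_not heP (fun x y => x ≠ y ∧ c s(x, y) = i) hC hD h
    exact ⟨C', hC', hC'J, D', hD', hD'J, Or.inl h'⟩
  · obtain ⟨D', hD', hD'J, C', hC', hC'J, h'⟩ :=
      hJ.exists_pos_forall_not heP (fun x y => y ≠ x ∧ c s(y, x) = j) hD hC h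
    exact ⟨C', hC', hC'J, D', hD', hD'J, Or.inr h'⟩

theorem IsFineNormalOn.exists_ne (hJ : IsFineNormalOn Λ J) (hF : ∀ M ∈ Λ, eP (F M) ∉ M)
    (hC : C ∈ pos H J) (x : X) : ∃ N ∈ C, eP x ∈ N ∧ x ≠ F N := by
  have h := hJ.inter_mem_pos (hJ.pos_diff hC (hJ.fine.2.2 (eP x)))
  obtain ⟨N, ⟨hNC, hN⟩, hNΛ⟩ : ((C \ {M ∈ Pom H | eP x ∉ M}) ∩ Λ).Nonempty := by
    rw [Set.nonempty_iff_ne_empty]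
    exact fun h' => h.2 (h' ▸ hJ.fine.1.empty_mem)
  have hxN : eP x ∈ N := by_contra fun h' => hN ⟨hC.1 hNC, h'⟩
  exact ⟨N, hNC, hxN, fun h' => hF N hNΛ (h' ▸ hxN)⟩

theorem IsFineNormalOn.not_forall_absUnsat (hJ : IsFineNormalOn Λ J)
    (hF : ∀ M ∈ Λ, eP (F M) ∉ M) (hC : C ∈ pos H J) (hD : D ∈ pos H J) :
    ¬ ∀ i j : Fin K, AbsUnsat c F eP C D i j := by
  have hne : ∀ {A : Set (Set H)}, A ∈ pos H J → ∃ M, M ∈ A := fun {A} hA =>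
    Set.nonempty_iff_ne_empty.2 fun h' => hA.2 (h' ▸ hJ.fine.1.empty_mem)
  intro h
  by_cases h1 : ∀ i, ∀ M ∈ C, ∀ N ∈ D, eP (F M) ∈ N → ¬ (F M ≠ F N ∧ c s(F M, F N) = i)
  · obtain ⟨M, hM⟩ := hne hC
    obtain ⟨N, hN, hMN, hFN⟩ := hJ.exists_ne hF hD (F M)
    exact h1 _ M hM N hN hMN ⟨hFN, rfl⟩
  · obtain ⟨i, hi⟩ := not_forall.1 h1
    obtain ⟨N, hN⟩ := hne hD
    obtain ⟨M, hM, hNM, hFM⟩ := hJ.exists_ne hF hC (F N)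
    exact (h i (c s(F M, F N))).resolve_left hi N hN M hM hNM ⟨hFM.symm, rfl⟩

/-- The sets of pairs of colours for which some pair of `J`-positive sets is simultaneously
absolutely unsaturated. -/
def unsatTypes (c : Sym2 X → Fin K) (F : Set H → X) (eP : X → H) (J : Set (Set (Set H))) :
    Set (Set (Fin K × Fin K)) :=
  {P | ∃ C ∈ pos H J, ∃ D ∈ pos H J, ∀ p ∈ P, AbsUnsat c F eP C D p.1 p.2}

theorem pos_anti {J₁ : Set (Set (Set H))} (h : J ⊆ J₁) : pos H J₁ ⊆ pos H J :=
  fun _ hA => ⟨hA.1, fun h' => hA.2 (h h')⟩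

theorem unsatTypes_anti {J₁ : Set (Set (Set H))} (h : J ⊆ J₁) :
    unsatTypes c F eP J₁ ⊆ unsatTypes c F eP J := by
  rintro P ⟨C, hC, D, hD, hP⟩
  exact ⟨C, pos_anti h hC, D, pos_anti h hD, hP⟩

/-- If `P` is a maximal unsaturated type of an ideal `J₁`, and `p ∉ P`, then every absolutely
`P`-unsaturated pair is `p`-saturated. -/
theorem IsFineNormalOn.sat_of_maximal (hJ : IsFineNormalOn Λ J) (heP : Function.Injective eP)
    {P : Set (Fin K × Fin K)} (hP : Maximal (· ∈ unsatTypes c F eP J) P) {i j : Fin K}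
    (hij : (i, j) ∉ P) (hCD : ∀ p ∈ P, AbsUnsat c F eP C D p.1 p.2) : Sat c J F C D i j := by
  intro C₁ hC₁ hC₁J D₁ hD₁ hD₁J
  by_contra h
  obtain ⟨C', hC', hC'J, D', hD', hD'J, h'⟩ := hJ.exists_absUnsat heP hC₁J hD₁J h
  refine hij (hP.le_of_ge (y := insert (i, j) P) ⟨C', hC'J, D', hD'J, ?_⟩
    (Set.subset_insert _ _) (Set.mem_insert _ _))
  rintro p (rfl | hp)
  · exact h'
  · exact (hCD p hp).mono (hC'.trans hC₁) (hD'.trans hD₁)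

/-- There is an ideal whose unsaturated types are the same as those of all larger ideals. -/
theorem exists_stable_ideal (c : Sym2 X → Fin K) (F : Set H → X) (eP : X → H)
    (hΛ : IsStationary H Λ) :
    ∃ J, IsFineNormalOn Λ J ∧ ∀ J₁, IsFineNormalOn Λ J₁ → J ⊆ J₁ →
      unsatTypes c F eP J₁ = unsatTypes c F eP J := by
  obtain ⟨_, ⟨J, hJ, rfl⟩, hmin⟩ :=
    (Set.toFinite ((unsatTypes c F eP) '' {J | IsFineNormalOn Λ J})).exists_minimal
      ⟨_, _, IsFineNormalOn.nonstationary hΛ, rfl⟩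
  exact ⟨J, hJ, fun J₁ hJ₁ h => (unsatTypes_anti h).antisymm
    (hmin ⟨J₁, hJ₁, rfl⟩ (unsatTypes_anti h))⟩

theorem IsFineNormalOn.exists_maximal_unsatType (hJ : IsFineNormalOn Λ J) (hΛ : Λ ⊆ Pom H)
    (hF : ∀ M ∈ Λ, eP (F M) ∉ M) (c : Sym2 X → Fin K) :
    ∃ P, Maximal (· ∈ unsatTypes c F eP J) P ∧ ∃ i j, (i, j) ∉ P := by
  obtain ⟨P, hP⟩ := (Set.toFinite (unsatTypes c F eP J)).exists_maximal
    ⟨∅, Λ, hJ.mem_pos_self hΛ, Λ, hJ.mem_pos_self hΛ, by simp⟩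
  refine ⟨P, hP, ?_⟩
  by_contra! h
  obtain ⟨C, hC, D, hD, hCD⟩ := hP.1
  exact hJ.not_forall_absUnsat hF hC hD fun i j => hCD _ (h i j)

/-- Shrinking a positive set so that its points lie in the first `k + 1` neighbourhoods of each
other. -/
theorem IsFineNormalOn.exists_homogeneous (hJ : IsFineNormalOn Λ J) {U : X → ℕ → Set X}
    (hU : ∀ x m, x ∈ U x m) {eS : Set X → H} (heS : Function.Injective eS)
    (hF : ∀ M ∈ Λ, ∀ k, eS (U (F M) k) ∈ M) {B : Set (Set H)} (hB : B ∈ pos H J) (hBΛ : B ⊆ Λ)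
    (k : ℕ) :
    ∃ C ⊆ B, C ∈ pos H J ∧ ∀ M ∈ C, ∀ N ∈ C, ∀ m < k, F N ∈ U (F M) m := by
  induction k with
  | zero => exact ⟨B, subset_rfl, hB, by simp⟩
  | succ k ih =>
    obtain ⟨C, hCB, hC, hk⟩ := ih
    obtain ⟨x, hx⟩ : ∃ x, {M ∈ C | eS (U (F M) k) = x} ∉ J := by
      by_contra! h
      refine hC.2 (hJ.mono (hJ.relUnion_mem_mem h) fun M hM => ?_)
      exact ⟨hC.1 hM, _, hF M (hBΛ (hCB hM)) k, hM, rfl⟩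
    refine ⟨_, fun M hM => hCB hM.1, ⟨fun M hM => hC.1 hM.1, hx⟩, ?_⟩
    rintro M ⟨hM, hMx⟩ N ⟨hN, hNx⟩ m hm
    rcases Nat.lt_succ_iff_lt_or_eq.1 hm with hm | rfl
    · exact hk M hM N hN m hm
    · rw [heS (hMx.trans hNx.symm)]
      exact hU _ _

end AbsUnsat

end Galvin

namespace Galvin

/-! ### Descending through a relation modulo an ideal -/

section Big

variable {H α : Type u} {Λ : Set (Set H)} {J : Set (Set (Set H))} {R : Set H → α → α → Prop}
  {f : Set H → α} {E : Set (Set H)}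

/-- `Big J R ξ f E` says that, modulo `J`, the rank of `f` restricted to `E` in the ultrapower-like
tree of functions into `α`, where the children of `f` are the `g` with `R M (f M) (g M)` for
`J`-almost all `M ∈ E`, is at least `ξ`. -/
def Big (J : Set (Set (Set H))) (R : Set H → α → α → Prop) (ξ : Ordinal.{u}) (f : Set H → α)
    (E : Set (Set H)) : Prop :=
  ∀ η, η < ξ → ∃ g, {M ∈ E | ¬ R M (f M) (g M)} ∈ J ∧ Big J R η g E
termination_by ξ

theorem big_iff {ξ : Ordinal.{u}} : Big J R ξ f E ↔
    ∀ η < ξ, ∃ g, {M ∈ E | ¬ R M (f M) (g M)} ∈ J ∧ Big J R η g E := by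
  rw [Big]

theorem Big.of_le {ξ η : Ordinal.{u}} (h : Big J R ξ f E) (hle : η ≤ ξ) : Big J R η f E :=
  big_iff.2 fun ν hν => big_iff.1 h ν (hν.trans_le hle)

theorem Big.congr {ξ : Ordinal.{u}} {f' : Set H → α} (h : Big J R ξ f E)
    (hff' : ∀ M ∈ E, f M = f' M) : Big J R ξ f' E := by
  refine big_iff.2 fun η hη => ?_
  obtain ⟨g, hg, hgE⟩ := big_iff.1 h η hη
  have heq : {M ∈ E | ¬ R M (f' M) (g M)} = {M ∈ E | ¬ R M (f M) (g M)} := by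
    ext M
    exact and_congr_right fun hM => by rw [hff' M hM]
  exact ⟨g, heq ▸ hg, hgE⟩

theorem Big.mono (hJ : IsFineNormalOn Λ J) {ξ : Ordinal.{u}} {E' : Set (Set H)}
    (h : Big J R ξ f E) (hE : E' ⊆ E) : Big J R ξ f E' := by
  induction ξ using WellFoundedLT.induction generalizing f with
  | ind ξ ih =>
    refine big_iff.2 fun η hη => ?_
    obtain ⟨g, hg, hgE⟩ := big_iff.1 h η hη
    exact ⟨g, hJ.mono hg fun M hM => ⟨hE hM.1, hM.2⟩, ih η hη hgE⟩

theorem IsFineNormalOn.big_of_mem (hJ : IsFineNormalOn Λ J) (hE : E ∈ J) (ξ : Ordinal.{u}) :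
    Big J R ξ f E := by
  induction ξ using WellFoundedLT.induction with
  | ind ξ ih => exact big_iff.2 fun η hη => ⟨f, hJ.mono hE fun M hM => hM.1, ih η hη⟩

open Classical in
theorem Big.relUnion (hJ : IsFineNormalOn Λ J) {ι : Type w} {r : ι → Set H → Prop}
    (hr : ∀ A : ι → Set (Set H), (∀ x, A x ∈ J) → relUnion r A ∈ J) {ξ : Ordinal.{u}}
    {E : ι → Set (Set H)} (h : ∀ x, Big J R ξ f (E x)) : Big J R ξ f (relUnion r E) := by
  induction ξ using WellFoundedLT.induction generalizing f E with
  | ind ξ ih =>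
    refine big_iff.2 fun η hη => ?_
    choose g hg hgE using fun x => big_iff.1 (h x) η hη
    let g' : Set H → α := fun M =>
      if hM : ∃ x, r x M ∧ M ∈ E x then g hM.choose M else f M
    let E' : ι → Set (Set H) := fun x => {M ∈ E x | ∃ hM : ∃ x, r x M ∧ M ∈ E x, hM.choose = x}
    have hE' : Galvin.relUnion r E = Galvin.relUnion r E' := by
      ext M
      refine and_congr_right fun _ => ⟨fun hM => ?_, fun ⟨x, hx, hM⟩ => ⟨x, hx, hM.1⟩⟩
      exact ⟨hM.choose, hM.choose_spec.1, hM.choose_spec.2, hM, rfl⟩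
    have hg' : ∀ x, ∀ M ∈ E' x, g x M = g' M := by
      rintro _ M ⟨_, hM, rfl⟩
      simp only [g', dif_pos hM]
    refine ⟨g', hJ.mono (hr _ hg) ?_, ?_⟩
    · rw [hE']
      rintro M ⟨⟨hM, x, hx, hMx⟩, hMR⟩
      exact ⟨hM, x, hx, hMx.1, by rwa [hg' x M hMx]⟩
    · rw [hE']
      exact ih η hη fun x => ((hgE x).mono hJ fun M hM => hM.1).congr (hg' x)

theorem exists_child_of_forall_big (h : ∀ ξ, Big J R ξ f E) :
    ∃ g, {M ∈ E | ¬ R M (f M) (g M)} ∈ J ∧ ∀ ξ, Big J R ξ g E := by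
  by_contra! hcon
  have hex : ∀ g : Set H → α, ∃ ξ, {M ∈ E | ¬ R M (f M) (g M)} ∈ J → ¬ Big J R ξ g E := fun g => by
    by_cases hg : {M ∈ E | ¬ R M (f M) (g M)} ∈ J
    · exact (hcon g hg).imp fun _ hξ _ => hξ
    · exact ⟨0, fun h' => absurd h' hg⟩
  choose ξ hξ using hex
  obtain ⟨g, hg, hgE⟩ := big_iff.1 (h (Order.succ (⨆ g, ξ g))) _ (Order.lt_succ _)
  exact hξ g hg (hgE.of_le (Ordinal.le_iSup ξ g))

/-- A function of unbounded rank yields an infinite path at some `M ∈ E`. -/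
theorem IsFineNormalOn.exists_path (hJ : IsFineNormalOn Λ J) (hE : E ∉ J)
    (h : ∀ ξ, Big J R ξ f E) :
    ∃ M ∈ E, ∃ s : ℕ → α, s 0 = f M ∧ ∀ n, R M (s n) (s (n + 1)) := by
  have hex : ∀ g : {g // ∀ ξ, Big J R ξ g E}, ∃ g' : {g // ∀ ξ, Big J R ξ g E},
      {M ∈ E | ¬ R M (g.1 M) (g'.1 M)} ∈ J := fun g => by
    obtain ⟨g', h1, h2⟩ := exists_child_of_forall_big g.2
    exact ⟨⟨g', h2⟩, h1⟩
  choose next hnext using hex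
  let s : ℕ → {g // ∀ ξ, Big J R ξ g E} := fun n => next^[n] ⟨f, h⟩
  have hs : ∀ n, {M ∈ E | ¬ R M ((s n).1 M) ((s (n + 1)).1 M)} ∈ J := fun n => by
    have : s (n + 1) = next (s n) := Function.iterate_succ_apply' next n _
    rw [this]
    exact hnext _
  obtain ⟨M, hM, hMs⟩ :
      (E \ ⋃ n, {M ∈ E | ¬ R M ((s n).1 M) ((s (n + 1)).1 M)}).Nonempty := by
    rw [Set.nonempty_iff_ne_empty]
    exact fun h' => hJ.diff_notMem hE (hJ.fine.2.1 _ hs) (h' ▸ hJ.fine.1.empty_mem)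
  refine ⟨M, hM, fun n => (s n).1 M, rfl, fun n => ?_⟩
  by_contra hn
  exact hMs (Set.mem_iUnion.2 ⟨n, hM, hn⟩)

/-- The ideal of sets on which `f`, restricted to `C`, has rank at least `ξ`. -/
theorem IsFineNormalOn.bigIdeal (hJ : IsFineNormalOn Λ J) {ξ : Ordinal.{u}} {C : Set (Set H)}
    (hC : C ⊆ Pom H) (h : ¬ Big J R ξ f C) :
    IsFineNormalOn Λ {E | E ⊆ Pom H ∧ Big J R ξ f (E ∩ C)} := by
  have hmem : ∀ A ∈ J, A ⊆ Pom H ∧ Big J R ξ f (A ∩ C) := fun A hA =>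
    ⟨hJ.subset_pom hA, hJ.big_of_mem (hJ.mono hA Set.inter_subset_left) ξ⟩
  refine of_relUnion (fun A hA => hA.1)
    (fun A hA B hB => ⟨hB.trans hA.1, hA.2.mono hJ (Set.inter_subset_inter_left _ hB)⟩)
    (fun h' => h (h'.2.mono hJ fun M hM => ⟨hC hM, hM⟩))
    (fun x => hmem _ (hJ.fine.2.2 x)) (hmem _ hJ.compl_mem)
    (fun A hA => ⟨fun M hM => hM.1,
      (Big.relUnion hJ (fun _ => hJ.relUnion_true_mem) fun n => (hA n).2).mono hJ ?_⟩)
    (fun A hA => ⟨fun M hM => hM.1,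
      (Big.relUnion hJ (fun _ => hJ.relUnion_mem_mem) fun n => (hA n).2).mono hJ ?_⟩)
  all_goals
    rintro M ⟨⟨hM, x, hx, hMx⟩, hMC⟩
    exact ⟨hM, x, hx, hMx, hMC⟩

theorem IsFineNormalOn.subset_bigIdeal (hJ : IsFineNormalOn Λ J) (ξ : Ordinal.{u})
    (f : Set H → α) (C : Set (Set H)) : J ⊆ {E | E ⊆ Pom H ∧ Big J R ξ f (E ∩ C)} := fun _ hA =>
  ⟨hJ.subset_pom hA, hJ.big_of_mem (hJ.mono hA Set.inter_subset_left) ξ⟩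

end Big

end Galvin

namespace Galvin

/-! ### Building winners -/

section Winner

variable {H : Type u} {X : Type v} {K : ℕ} {Λ : Set (Set H)} {J : Set (Set (Set H))}
  {F : Set H → X} {eP : X → H} {c : Sym2 X → Fin K} {U : X → ℕ → Set X} {i j : Fin K}

/-- One step of the construction of a winner `F M`: `p` consists of a set from which the remaining
members of the sequence are to be chosen, and of the number of steps made so far. -/
def WinnerStep (c : Sym2 X → Fin K) (J : Set (Set (Set H))) (F : Set H → X) (U : X → ℕ → Set X)
    (i j : Fin K) (M : Set H) (p q : Set (Set H) × ℕ) : Prop :=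
  q.2 = p.2 + 1 ∧ M ∈ q.1 ∧ q.1 ⊆ p.1 ∧ ∃ T ⊆ p.1, T ∈ pos H J ∧ Sat c J F q.1 T i j ∧
    (∀ N ∈ T, F N ≠ F M ∧ c s(F M, F N) = i) ∧ ∀ m ≤ p.2, ∀ N ∈ T, F N ∈ U (F M) m

theorem isWinner_of_path {M : Set H} {B : Set (Set H)} {s : ℕ → Set (Set H) × ℕ}
    (h0 : (s 0).1 ⊆ B) (hs : ∀ n, WinnerStep c J F U i j M (s n) (s (n + 1))) :
    IsWinner c J F U B i j (F M) := by
  have hk : ∀ n, n ≤ (s n).2 := fun n => by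
    induction n with
    | zero => exact Nat.zero_le _
    | succ n ih => rw [(hs n).1]; lia
  have hanti : Antitone fun n => (s n).1 := antitone_nat_of_succ_le fun n => (hs n).2.2.1
  choose _ hM hsub T hTs hT hsat hTi hTU using hs
  refine ⟨⟨M, h0 (hsub 0 (hM 0)), rfl⟩, T,
    fun n => ⟨(hTs n).trans ((hanti (Nat.zero_le n)).trans h0), hT n⟩, hTi, fun k l hkl => ?_,
    fun n => hTU n n (hk n)⟩
  exact fun C hC => hsat k C (hC.trans ((hTs l).trans (hanti (Nat.succ_le_of_lt hkl))))

theorem IsFineNormalOn.exists_isWinner (hJ : IsFineNormalOn Λ J)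
    (hstable : ∀ J₁, IsFineNormalOn Λ J₁ → J ⊆ J₁ → unsatTypes c F eP J₁ = unsatTypes c F eP J)
    (heP : Function.Injective eP) {P : Set (Fin K × Fin K)}
    (hP : Maximal (· ∈ unsatTypes c F eP J) P) (hij : (i, j) ∉ P)
    (hU : ∀ x m, x ∈ U x m) {eS : Set X → H} (heS : Function.Injective eS)
    (hF : ∀ M ∈ Λ, ∀ k, eS (U (F M) k) ∈ M) {B : Set (Set H)} (hBΛ : B ⊆ Λ)
    (hB : B ∈ pos H J) : ∃ x, IsWinner c J F U B i j x := by
  by_contra! hno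
  let R := WinnerStep c J F U i j
  have hsmall : ∃ ξ : Ordinal.{u}, ∃ C ⊆ B, C ∈ pos H J ∧ ∃ k : ℕ,
      ¬ Big J R ξ (fun _ => (C, k)) C := by
    by_contra! h
    obtain ⟨M, -, s, hs0, hs⟩ := hJ.exists_path (f := fun _ => (B, 0)) hB.2
      fun ξ => h ξ B subset_rfl hB 0
    exact hno _ (isWinner_of_path (by rw [hs0]) hs)
  obtain ⟨ξ, ⟨C, hCB, hC, k, hnot⟩, hmin⟩ := WellFounded.has_min
    (wellFounded_lt (α := Ordinal.{u})) _ hsmall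
  have hJ' := hJ.bigIdeal hC.1 hnot
  have hJJ' := hJ.subset_bigIdeal (R := R) ξ (fun _ => (C, k)) C
  set J' := {E | E ⊆ Pom H ∧ Big J R ξ (fun _ => (C, k)) (E ∩ C)}
  have hCJ' : C ∈ pos H J' := ⟨hC.1, fun h => hnot (by simpa using h.2)⟩
  obtain ⟨C', hC'C, hC'J', hhom⟩ :=
    hJ'.exists_homogeneous hU heS hF hCJ' (hCB.trans hBΛ) (k + 1)
  have hPJ'' : P ∈ unsatTypes c F eP (add H J' C') := by
    rw [hstable _ (hJ'.restrict hC'J') (hJJ'.trans (hJ'.subset_add C'))]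
    exact hP.1
  obtain ⟨C₀, hC₀, D₀, hD₀, hCD⟩ := hPJ''
  have hinter : ∀ A ∈ pos H (add H J' C'), A ∩ C' ∈ pos H J' := fun A hA =>
    ⟨Set.inter_subset_left.trans hA.1, fun h => hA.2 ⟨hA.1, h⟩⟩
  have hCD' : ∀ p ∈ P, AbsUnsat c F eP (C₀ ∩ C') (D₀ ∩ C') p.1 p.2 := fun p hp =>
    (hCD p hp).mono Set.inter_subset_left Set.inter_subset_left
  have hsat : Sat c J F (C₀ ∩ C') (D₀ ∩ C') i j := hJ.sat_of_maximal heP hP hij hCD'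
  have hsat' : Sat c J' F (C₀ ∩ C') (D₀ ∩ C') i j :=
    hJ'.sat_of_maximal heP (by rwa [hstable J' hJ' hJJ']) hij hCD'
  have hC₀' := hinter C₀ hC₀
  have hD₀' := hinter D₀ hD₀
  have hw := (hsat' _ subset_rfl hC₀' _ subset_rfl hD₀').1
  rw [IsFineNormalOn.eIdeal_iff hC₀'.1] at hw
  set C₁ := {M ∈ C₀ ∩ C' | eIdeal J' (D₀ ∩ C') fun N => F M ≠ F N ∧ c s(F M, F N) = i}
  have hC₁C : C₁ ⊆ C := fun M hM => hC'C hM.1.2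
  have hC₁J : C₁ ∈ pos H J := ⟨hC₁C.trans hC.1, fun h => hw (hJJ' h)⟩
  have hstep : ∀ M ∈ C₁, R M (C, k) (C₁, k + 1) := by
    rintro M ⟨hM, hMe⟩
    have hMe' := hMe
    rw [IsFineNormalOn.eIdeal_iff hD₀'.1] at hMe'
    refine ⟨rfl, ⟨hM, hMe⟩, hC₁C, _, fun N hN => hC'C hN.1.2,
      ⟨fun N hN => hD₀'.1 hN.1, fun h => hMe' (hJJ' h)⟩, ?_, fun N hN => ⟨hN.2.1.symm, hN.2.2⟩,
      fun m hm N hN => hhom M hM.2 N hN.1.2 m (Nat.lt_succ_of_le hm)⟩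
    exact fun A hA hAJ D hD => hsat A (hA.trans fun M hM => hM.1) hAJ D
      (hD.trans fun N hN => hN.1)
  refine hw ⟨hC₁J.1, Big.mono hJ (big_iff.2 fun η hη => ?_) Set.inter_subset_left⟩
  refine ⟨fun _ => (C₁, k + 1), hJ.mono hJ.fine.1.empty_mem ?_, ?_⟩
  · exact fun M hM => hM.2 (hstep M hM.1)
  · by_contra h
    exact hmin η ⟨C₁, hC₁C.trans hCB, hC₁J, k + 1, h⟩ hη

end Winner

/-- Lemma 7.1 (the main lemma): with `X` a regular Hausdorff space with point-countable
basis `𝔅`, enumerations `U x` of the basic neighbourhoods of each point, a colouring `c`,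
a set `H` containing (via the injections `eP`, `eS`) all points of `X` and all members of
`𝔅`, a stationary `Λ ⊆ P_{ω₁}(H)` and `F : Λ → X` with `F(M) ∉ M` and `U_{F(M),k} ∈ M`
for all `M ∈ Λ` and `k < ω`, there are a fine normal ideal `I` on `P_{ω₁}(H)` and an
`I`-positive `A ⊆ Λ` such that `(A, I)` is a winning pair for `c`. -/
theorem main_lemma_winning_pair {H : Type u} {X : Type v} [TopologicalSpace X]
    [T2Space X] [RegularSpace X]
    (𝔅 : Set (Set X)) (h𝔅 : TopologicalSpace.IsTopologicalBasis 𝔅)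
    (hpc : ∀ x : X, {V ∈ 𝔅 | x ∈ V}.Countable)
    (U : X → ℕ → Set X) (hU : ∀ x : X, Set.range (U x) = {V ∈ 𝔅 | x ∈ V})
    (K : ℕ) (hK : 0 < K) (c : Sym2 X → Fin K)
    (eP : X → H) (heP : Function.Injective eP)
    (eS : Set X → H) (heS : Function.Injective eS)
    (Λ : Set (Set H)) (hΛ : IsStationary H Λ)
    (F : Set H → X)
    (hF : ∀ M ∈ Λ, eP (F M) ∉ M ∧ ∀ k : ℕ, eS (U (F M) k) ∈ M) :
    ∃ I : Set (Set (Set H)), IsFineIdeal H I ∧ IsNormal H I ∧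
      ∃ A ⊆ Λ, A ∈ pos H I ∧ IsWinningPair c I F U A := by
  have hU' : ∀ x m, x ∈ U x m := fun x m =>
    (((hU x).subset ⟨m, rfl⟩ : U x m ∈ {V ∈ 𝔅 | x ∈ V})).2
  have hFP : ∀ M ∈ Λ, eP (F M) ∉ M := fun M hM => (hF M hM).1
  obtain ⟨J, hJ, hstable⟩ := exists_stable_ideal c F eP hΛ
  obtain ⟨P, hP, i, j, hij⟩ := hJ.exists_maximal_unsatType hΛ.1 hFP c
  exact ⟨J, hJ.fine, hJ.normal, Λ, subset_rfl, hJ.mem_pos_self hΛ.1, i, j, fun B hBΛ hB =>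
    hJ.exists_isWinner hstable heP hP hij hU' heS (fun M hM => (hF M hM).2) hBΛ hB⟩

end Galvin
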